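/- Over the alphabet {1 < b} with b even, there is no infinite smooth word that is also an infinite Lyndon word. In particular, over {1, 2}, no infinite smooth word (e.g., no word in the class containing the Kolakoski word) is an infinite Lyndon word. -/

import Mathlib

/-- Strict lexicographic order on infinite words. -/
def InfLex {α : Type*} [LT α] (u v : ℕ → α) : Prop :=
  ∃ k, (∀ j < k, u j = v j) ∧ u k < v k

/-- An infinite word is an infinite Lyndon word if it is lexicographically smaller
than all of its proper suffixes. -/
def IsInfLyndon {α : Type*} [LT α] (w : ℕ → α) : Prop :=
  ∀ i, 0 < i → InfLex w (fun n => w (n + i))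

/-- Partial sums of an infinite sequence of block lengths. -/
def psum (u : ℕ → ℕ) : ℕ → ℕ
  | 0 => 0
  | k + 1 => psum u k + u k

/-- The index of the maximal block containing position `n` in the word whose block
lengths are given by `u`. -/
def blockIdx (u : ℕ → ℕ) (n : ℕ) : ℕ :=
  Nat.findGreatest (fun k => psum u k ≤ n) n

/-- `expand x y u` is the infinite word `x^{u 0} y^{u 1} x^{u 2} ⋯` whose run-length
encoding is `u` and whose letters alternate between `x` and `y`, starting with `x`;
i.e. the pseudo-inverse `Δ⁻¹_x(u)` over the alphabet `{x, y}`. -/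
def expand (x y : ℕ) (u : ℕ → ℕ) (n : ℕ) : ℕ :=
  if blockIdx u n % 2 = 0 then x else y

/-- `SmoothChain a b W` says that `W k` is the sequence of iterated run-length
encodings `Δᵏ(W 0)` over the alphabet `{a, b}`: each `W k` is a word over `{a, b}`
and is recovered from its run-length encoding `W (k+1)` by alternating expansion
starting with its own first letter. -/
def SmoothChain (a b : ℕ) (W : ℕ → ℕ → ℕ) : Prop :=
  ∀ k, (∀ n, W k n = a ∨ W k n = b) ∧
    W k = expand (W k 0) (if W k 0 = a then b else a) (W (k + 1))

/-- An infinite word `w` is smooth over `{a, b}` if all its iterated run-length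
encodings `Δᵏ(w)` are infinite words over `{a, b}`. -/
def IsSmooth (a b : ℕ) (w : ℕ → ℕ) : Prop :=
  ∃ W : ℕ → ℕ → ℕ, W 0 = w ∧ SmoothChain a b W

/-! ### Binary words and their run-length codings -/

/-- The length of a block coded by a letter: `true` stands for `b`, `false` for `1`. -/
def blockLen (b : ℕ) (c : Bool) : ℕ := bif c then b else 1

/-- The starting position of the `k`-th block of a word whose block lengths are coded by `y`. -/
def blockPos (b : ℕ) (y : ℕ → Bool) (k : ℕ) : ℕ := psum (fun i => blockLen b (y i)) k

/-- `y` codes the block lengths of the alternating word `x`. -/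
def IsCoding (b : ℕ) (x y : ℕ → Bool) : Prop :=
  ∀ k m, m < blockLen b (y k) → x (blockPos b y k + m) = (x 0 ^^ k.bodd)

/-- At the first difference between `x` and `z`, the letter of `x` is the one given by `P`. -/
def Prefers (x z P : ℕ → Bool) : Prop :=
  ∀ k, (∀ l < k, x l = z l) → x k ≠ z k → x k = P k

/-- The preference inherited by a coding `y` of `x` from the preference `P` on `x`. -/
def liftPref (b : ℕ) (x y P : ℕ → Bool) (k : ℕ) : Bool :=
  P (blockPos b y k + 1) == (x 0 ^^ k.bodd)

theorem psum_add (u : ℕ → ℕ) (i k : ℕ) :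
    psum u (i + k) = psum u i + psum (fun n => u (i + n)) k := by
  induction k with
  | zero => rfl
  | succ k ih => rw [← add_assoc, psum, ih, psum, add_assoc]

theorem psum_congr {u v : ℕ → ℕ} {k : ℕ} (h : ∀ i < k, u i = v i) : psum u k = psum v k := by
  induction k with
  | zero => rfl
  | succ k ih => rw [psum, psum, ih fun i hi => h i (by omega), h k (by omega)]

theorem psum_mono {u : ℕ → ℕ} : Monotone (psum u) :=
  monotone_nat_of_le_succ fun _ => Nat.le_add_right _ _

theorem le_psum {u : ℕ → ℕ} (hu : ∀ i, 0 < u i) (k : ℕ) : k ≤ psum u k := by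
  induction k with
  | zero => exact Nat.zero_le _
  | succ k ih => have := hu k; rw [psum]; omega

theorem blockIdx_psum_add {u : ℕ → ℕ} (hu : ∀ i, 0 < u i) {k m : ℕ} (hm : m < u k) :
    blockIdx u (psum u k + m) = k := by
  have hk := le_psum hu k
  refine (Nat.findGreatest_eq_iff).2 ⟨by omega, fun _ => Nat.le_add_right _ _, fun n hn _ h => ?_⟩
  have : psum u (k + 1) ≤ psum u n := psum_mono hn
  rw [psum] at this
  omega

theorem exists_psum_add {u : ℕ → ℕ} {k l : ℕ} (hl : l < psum u k) :
    ∃ i < k, ∃ m < u i, l = psum u i + m := by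
  induction k with
  | zero => exact absurd hl (Nat.not_lt_zero _)
  | succ k ih =>
    rcases lt_or_ge l (psum u k) with h | h
    · obtain ⟨i, hi, m, hm, e⟩ := ih h
      exact ⟨i, by omega, m, hm, e⟩
    · rw [psum] at hl
      exact ⟨k, by omega, l - psum u k, by omega, by omega⟩

section Coding

variable {b : ℕ} {x y z y' P : ℕ → Bool}

@[simp] theorem blockPos_zero : blockPos b y 0 = 0 := rfl

theorem blockPos_succ (k : ℕ) : blockPos b y (k + 1) = blockPos b y k + blockLen b (y k) := rfl

theorem blockPos_add (i k : ℕ) :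
    blockPos b y (i + k) = blockPos b y i + blockPos b (fun n => y (i + n)) k :=
  psum_add _ _ _

theorem blockLen_pos (hb : 1 < b) (c : Bool) : 0 < blockLen b c := by
  cases c
  · exact Nat.one_pos
  · exact hb.le

theorem bodd_blockLen (hbe : b.bodd = false) (c : Bool) : (blockLen b c).bodd = !c := by
  cases c
  · simp [blockLen]
  · exact hbe

theorem bodd_blockPos_succ (hbe : b.bodd = false) (k : ℕ) :
    (blockPos b y (k + 1)).bodd = ((blockPos b y k).bodd ^^ !y k) := by
  rw [blockPos_succ, Nat.bodd_add, bodd_blockLen hbe]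

/-- The parity of the block position after a stretch of equal letters. -/
theorem bodd_blockPos_add (hbe : b.bodd = false) {n m : ℕ} {c : Bool}
    (h : ∀ i < m, y (n + i) = c) :
    (blockPos b y (n + m)).bodd = ((blockPos b y n).bodd ^^ (m.bodd && !c)) := by
  induction m with
  | zero => simp
  | succ m ih =>
    rw [← add_assoc, bodd_blockPos_succ hbe, ih fun i hi => h i (by omega), h m (by omega),
      Nat.bodd_succ]
    cases m.bodd <;> cases c <;> simp

theorem IsCoding.start (h : IsCoding b x y) (hb : 1 < b) (k : ℕ) :
    x (blockPos b y k) = (x 0 ^^ k.bodd) :=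
  h k 0 (blockLen_pos hb _)

theorem IsCoding.suffix (h : IsCoding b x y) (hb : 1 < b) {i : ℕ} (hi : i.bodd = false) :
    IsCoding b (fun n => x (blockPos b y i + n)) (fun n => y (i + n)) := by
  intro k m hm
  have := h (i + k) m hm
  rw [blockPos_add, add_assoc] at this
  simp only [add_zero, this, h.start hb, Nat.bodd_add, hi]
  simp

/-- The suffix of `x` starting at the last letter of a long block. -/
theorem IsCoding.suffix_last (h : IsCoding b x y) (hb : 1 < b) {i : ℕ} (hi : i.bodd = false)
    (hy : y i = true) :
    IsCoding b (fun n => x (blockPos b y i + (b - 1) + n))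
      (fun n => if n = 0 then false else y (i + n)) := by
  have h0 : x (blockPos b y i + (b - 1)) = x 0 := by
    rw [h i (b - 1) (by rw [hy]; change b - 1 < b; omega), hi, Bool.xor_false]
  intro k m hm
  rcases k with - | k
  · obtain rfl : m = 0 := by
      change m < 1 at hm
      omega
    simp
  · have hs := h (i + 1 + k) m (by simpa [add_assoc, add_comm 1 k] using hm)
    have e : blockPos b (fun n => if n = 0 then false else y (i + n)) (k + 1)
        = 1 + blockPos b (fun n => y (i + 1 + n)) k := by
      rw [add_comm k 1, blockPos_add]
      simp [blockPos_succ, blockLen, add_assoc]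
    have e2 : blockPos b y (i + 1) = blockPos b y i + b := by rw [blockPos_succ, hy]; rfl
    rw [blockPos_add, e2] at hs
    simp only [e, add_zero, h0]
    rw [show blockPos b y i + (b - 1) + (1 + blockPos b (fun n => y (i + 1 + n)) k + m)
      = blockPos b y i + b + blockPos b (fun n => y (i + 1 + n)) k + m by omega, hs]
    simp [Nat.bodd_add, hi]

theorem Prefers.contradiction {k : ℕ} {c : Bool} (h : Prefers x z P) (hx : x k = c)
    (hz : z k = !c) (hP : P k = !c) (hk : ∀ l < k, x l = z l) : False := by
  have := h k hk (by rw [hx, hz]; cases c <;> decide)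
  rw [hx, hP] at this
  exact absurd this (by cases c <;> decide)

theorem Prefers.lift (hb : 1 < b) (hx : IsCoding b x y) (hz : IsCoding b z y') (h0 : z 0 = x 0)
    (hP : Prefers x z P) : Prefers y y' (liftPref b x y P) := by
  intro k hk hne
  have hpos : ∀ i ≤ k, blockPos b y i = blockPos b y' i := fun i hi =>
    psum_congr fun l hl => by rw [hk l (by omega)]
  have hagree : ∀ l < blockPos b y k + 1, x l = z l := by
    intro l hl
    rcases Nat.lt_succ_iff_lt_or_eq.1 hl with hl | rfl
    · obtain ⟨i, hi, m, hm, rfl⟩ := exists_psum_add hl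
      have := hz i m (by rwa [← hk i hi])
      rw [← hpos i hi.le] at this
      exact (hx i m hm).trans (by rw [← h0]; exact this.symm)
    · rw [hx.start hb, hpos k le_rfl, hz.start hb, h0]
  have key := hP _ hagree
  unfold liftPref
  cases hy : y k
  · have hy' : y' k = true := by
      cases h : y' k
      · exact absurd (hy.trans h.symm) hne
      · rfl
    have h1 : x (blockPos b y k + 1) = (x 0 ^^ (k + 1).bodd) := by
      rw [← hx.start hb, blockPos_succ, hy]; rfl
    have h2 : z (blockPos b y k + 1) = (x 0 ^^ k.bodd) := by
      rw [hpos k le_rfl, hz k 1 (by rw [hy']; exact hb), h0]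
    rw [h1, h2, Nat.bodd_succ] at key
    have := key (by cases x 0 <;> cases k.bodd <;> decide)
    rw [← this]
    cases x 0 <;> cases k.bodd <;> rfl
  · have hy' : y' k = false := by
      cases h : y' k
      · rfl
      · exact absurd (hy.trans h.symm) hne
    have h1 : x (blockPos b y k + 1) = (x 0 ^^ k.bodd) :=
      hx k 1 (by rw [hy]; exact hb)
    have h2 : z (blockPos b y k + 1) = (x 0 ^^ (k + 1).bodd) := by
      rw [← h0, ← hz.start hb, blockPos_succ, hy', hpos k le_rfl]; rfl
    rw [h1, h2, Nat.bodd_succ] at key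
    have := key (by cases x 0 <;> cases k.bodd <;> decide)
    rw [← this]
    simp

end Coding

/-! ### Scanners -/

/-- A partially specified finite-state device reading a binary word from its start. It recognizes
positions from which the word prefers its own prefix, computes the preferred letter, and knows
letters that cannot be read in a given state. -/
structure Scanner (S : Type) where
  initial : S
  isInit : S → Bool
  step : S → Bool → Option S
  pref : S → Option Bool
  forb : S → Bool → Bool

namespace Scanner

section Basic

variable {S : Type}

/-- The `n`-th iterate of a partial map. -/
def iter (g : S → Option S) : ℕ → S → Option S
  | 0, s => some s
  | n + 1, s => match g s with
    | none => none
    | some t => iter g n t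

/-- Whether one of the first `n` iterates of `s` is bad. -/
def scan (g : S → Option S) (bad : S → Bool) : ℕ → S → Bool
  | 0, _ => false
  | n + 1, s => match bad s with
    | true => true
    | false => match g s with
      | none => false
      | some t => scan g bad n t

/-- A way to compute `iter g r s₁` (for `r` known modulo `p * 2 ^ (n - 1)`) by looking for a period
of the form `p * 2 ^ i` with `i < n`, where `t = iter g p s₁`. -/
def power [DecidableEq S] (g : S → Option S) (r : ℕ) (s₁ : S) : ℕ → ℕ → S → Option S
  | 0, _, _ => none
  | n + 1, p, t => if t = s₁ then iter g (r % p) s₁ else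
    match iter g p t with
    | none => none
    | some u => power g r s₁ n (2 * p) u

/-- The state after a block of letters `L` of length `blockLen b c`, where `b % 16 = r + 1`. -/
def block [DecidableEq S] (M : Scanner S) (r : ℕ) (L : Bool) (s : S) : Bool → Option S
  | true => match M.step s L with
    | none => none
    | some s₁ => match M.step s₁ L with
      | none => none
      | some t => power (fun t => M.step t L) r s₁ 5 1 t
  | false => M.step s L

/-- The scanner for a coding of a word beginning with `x₀`, given a scanner for the word. -/
def lift [DecidableEq S] (M : Scanner S) (r d : ℕ) (x₀ : Bool) : Scanner (Bool × S) where
  initial := (false, M.initial)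
  isInit s := !s.1 && M.isInit s.2
  step s c := match block M r (x₀ ^^ s.1) s.2 c with
    | none => none
    | some t => match s.1 with
      | true => some (false, t)
      | false => some (true, t)
  pref s := match M.step s.2 (x₀ ^^ s.1) with
    | none => none
    | some t => match M.pref t with
      | none => none
      | some p => some (p == (x₀ ^^ s.1))
  forb s c :=
    scan (fun t => M.step t (x₀ ^^ s.1)) (fun t => M.forb t (x₀ ^^ s.1))
      (match c with | true => d | false => 1) s.2 ||
    match block M r (x₀ ^^ s.1) s.2 c with
    | none => false
    | some t => M.forb t !(x₀ ^^ s.1)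

/-- Record the first letter `x₀` of the word: if the word does not begin with its preferred letter,
then no other letter can be read in an initial state. -/
def starting (M : Scanner S) (x₀ : Bool) : Scanner S :=
  { M with forb := fun s c => M.forb s c ||
      (M.isInit s && (c != x₀) && decide (M.pref M.initial = some !x₀)) }

/-- Search through the first letters of the iterated codings, up to depth `n`, whether all choices
lead to a forbidden letter. -/
def closes (r d : ℕ) : ℕ → ∀ (S : Type) [DecidableEq S], Scanner S → Bool
  | 0, _, _, _ => false
  | n + 1, S, _, M => [false, true].all fun c =>
      (M.starting c).forb M.initial c || closes r d n (Bool × S) ((M.starting c).lift r d c)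

/-- The state of a scanner before reading the letter `x k`. -/
def state (M : Scanner S) (x : ℕ → Bool) : ℕ → Option S
  | 0 => some M.initial
  | k + 1 => (M.state x k).bind fun s => M.step s (x k)

/-- The scanner `M` describes the word `x` correctly, for the preference `P`. -/
structure Valid (M : Scanner S) (x P : ℕ → Bool) : Prop where
  pref : ∀ {k s p}, M.state x k = some s → M.pref s = some p → P k = p
  prefers : ∀ {j s}, M.state x j = some s → M.isInit s = true → Prefers x (fun n => x (j + n)) P
  forb : ∀ {j s}, M.state x j = some s → M.forb s (x j) = false

theorem iter_succ (g : S → Option S) (n : ℕ) (s : S) :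
    iter g (n + 1) s = (g s).bind (iter g n) := by
  rw [iter]
  cases g s <;> rfl

theorem iter_add (g : S → Option S) (m n : ℕ) (s : S) :
    iter g (m + n) s = (iter g m s).bind (iter g n) := by
  induction m generalizing s with
  | zero => simp [iter]
  | succ m ih =>
    rw [Nat.succ_add, iter_succ, iter_succ]
    cases h : g s with
    | none => rfl
    | some t => simpa using ih t

theorem iter_mod {g : S → Option S} {p : ℕ} {s : S} (h : iter g p s = some s) (k : ℕ) :
    iter g (k % p) s = iter g k s := by
  have key : ∀ q, iter g (p * q) s = some s := by
    intro q
    induction q with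
    | zero => rfl
    | succ q ih => rw [Nat.mul_succ, iter_add, ih]; exact h
  conv_rhs => rw [← Nat.div_add_mod k p, iter_add, key]
  rfl

theorem power_spec [DecidableEq S] {g : S → Option S} {r k : ℕ} {s₁ u : S} (n p : ℕ) {t : S}
    (hk : k ≡ r [MOD p * 2 ^ (n - 1)]) (ht : iter g p s₁ = some t)
    (h : power g r s₁ n p t = some u) : iter g k s₁ = some u := by
  induction n generalizing p t with
  | zero => cases h
  | succ n ih =>
    rw [power] at h
    split_ifs at h with e
    · subst e
      have : k % p = r % p := hk.of_mul_right _
      rw [← iter_mod ht k, this, h]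
    · cases hv : iter g p t with
      | none => simp [hv] at h
      | some v =>
        simp only [hv] at h
        rcases n with - | n
        · cases h
        · refine ih (2 * p) ?_ ?_ h
          · have e : 2 * p * 2 ^ n = p * 2 ^ (n + 1) := by ring
            exact e ▸ hk
          · rw [two_mul, iter_add, ht]
            exact hv

theorem block_spec [DecidableEq S] {M : Scanner S} {b r : ℕ} {L c : Bool} {s t : S} (hb : 1 < b)
    (hr : b ≡ r + 1 [MOD 16]) (h : M.block r L s c = some t) :
    iter (fun t => M.step t L) (blockLen b c) s = some t := by
  cases c
  · change (match M.step s L with | none => none | some t => some t) = some t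
    change M.step s L = some t at h
    rw [h]
  · obtain ⟨k, rfl⟩ : ∃ k, b = k + 1 := ⟨b - 1, by omega⟩
    change iter _ (k + 1) s = _
    simp only [block] at h
    rw [iter_succ]
    cases h₁ : M.step s L with
    | none => simp [h₁] at h
    | some s₁ =>
      cases h₂ : M.step s₁ L with
      | none => simp [h₁, h₂] at h
      | some v =>
        simp only [h₁, h₂] at h
        exact power_spec 5 1 (Nat.ModEq.add_right_cancel' 1 hr) (by simp [iter, h₂]) h

theorem state_add {M : Scanner S} {x : ℕ → Bool} {j n : ℕ} {L : Bool} {s t : S}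
    (hs : M.state x j = some s) (hL : ∀ m < n, x (j + m) = L)
    (ht : iter (fun t => M.step t L) n s = some t) : M.state x (j + n) = some t := by
  induction n generalizing j s with
  | zero => exact hs.trans ht
  | succ n ih =>
    rw [iter_succ] at ht
    obtain ⟨u, hu, ht⟩ := Option.bind_eq_some_iff.1 ht
    have hx : x j = L := hL 0 (by omega)
    rw [← add_assoc, add_right_comm]
    refine ih (s := u) ?_ (fun m hm => ?_) ht
    · rw [state, hs, hx]
      exact hu
    · rw [add_right_comm, add_assoc]
      exact hL (m + 1) (by omega)

theorem scan_eq_false {M : Scanner S} {x P : ℕ → Bool} (hM : M.Valid x P) {j n : ℕ} {L : Bool}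
    {s : S} (hs : M.state x j = some s) (hL : ∀ m < n, x (j + m) = L) :
    scan (fun t => M.step t L) (fun t => M.forb t L) n s = false := by
  induction n generalizing j s with
  | zero => rfl
  | succ n ih =>
    have hx : x j = L := hL 0 (by omega)
    have hf := hM.forb hs
    rw [hx] at hf
    simp only [scan, hf]
    cases ht : M.step s L with
    | none => rfl
    | some t =>
      refine ih (j := j + 1) ?_ fun m hm => ?_
      · rw [state, hs, hx]
        exact ht
      · rw [add_right_comm, add_assoc]
        exact hL (m + 1) (by omega)

theorem Valid.starting {M : Scanner S} {x P : ℕ → Bool} (hM : M.Valid x P) :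
    (M.starting (x 0)).Valid x P := by
  have hst : (M.starting (x 0)).state x = M.state x := by
    funext k
    induction k with
    | zero => rfl
    | succ k ih => rw [state, state, ih]; rfl
  refine ⟨fun hs hp => hM.pref (hst ▸ hs) hp, fun hs hi => hM.prefers (hst ▸ hs) hi,
    fun {j s} hs => ?_⟩
  rw [hst] at hs
  simp only [Scanner.starting, hM.forb hs, Bool.false_or]
  by_contra hne
  simp only [Bool.not_eq_false, Bool.and_eq_true, bne_iff_ne, decide_eq_true_eq] at hne
  obtain ⟨⟨hi, hj⟩, hp⟩ := hne
  have h0 := hM.prefers hs hi 0 (fun l hl => absurd hl (Nat.not_lt_zero _)) (Ne.symm hj)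
  rw [hM.pref (k := 0) rfl hp] at h0
  cases h : x 0 <;> simp [h] at h0

theorem Valid.lift [DecidableEq S] {M : Scanner S} {b r d : ℕ} {x y P : ℕ → Bool} (hb : 1 < b)
    (hr : b ≡ r + 1 [MOD 16]) (hd : d ≤ b) (hxy : IsCoding b x y) (hM : M.Valid x P) :
    (M.lift r d (x 0)).Valid y (liftPref b x y P) := by
  have hst : ∀ {k s}, (M.lift r d (x 0)).state y k = some s →
      s.1 = k.bodd ∧ M.state x (blockPos b y k) = some s.2 := by
    intro k
    induction k with
    | zero =>
      intro s hs
      cases hs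
      exact ⟨rfl, rfl⟩
    | succ k ih =>
      intro s hs
      obtain ⟨q, hq, hs⟩ := Option.bind_eq_some_iff.1 hs
      obtain ⟨h1, h2⟩ := ih hq
      simp only [Scanner.lift] at hs
      cases ht : block M r (x 0 ^^ q.1) q.2 (y k) with
      | none => simp [ht] at hs
      | some t =>
        have h3 := state_add h2 (fun m hm => by rw [h1]; exact hxy k m hm) (block_spec hb hr ht)
        rw [ht] at hs
        rw [Nat.bodd_succ, ← h1]
        cases hq1 : q.1 <;> simp only [hq1, Option.some.injEq] at hs <;> subst hs <;>
          exact ⟨rfl, h3⟩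
  refine ⟨fun {k s p} hs hp => ?_, fun {j s} hs hi => ?_, fun {j s} hs => ?_⟩
  · obtain ⟨h1, h2⟩ := hst hs
    simp only [Scanner.lift] at hp
    cases ht : M.step s.2 (x 0 ^^ s.1) with
    | none => simp [ht] at hp
    | some t =>
      cases hq : M.pref t with
      | none => simp [ht, hq] at hp
      | some q =>
        simp only [ht, hq, Option.some.injEq] at hp
        rw [liftPref, hM.pref (s := t) _ hq, ← hp, h1]
        rw [state, h2, hxy.start hb, ← h1]
        exact ht
  · obtain ⟨h1, h2⟩ := hst hs
    simp only [Scanner.lift, Bool.and_eq_true, Bool.not_eq_true'] at hi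
    rw [hi.1] at h1
    refine Prefers.lift hb hxy (hxy.suffix hb h1.symm) ?_ (hM.prefers h2 hi.2)
    rw [add_zero, hxy.start hb, ← h1, Bool.xor_false]
  · obtain ⟨h1, h2⟩ := hst hs
    simp only [Scanner.lift, Bool.or_eq_false_iff]
    constructor
    · refine scan_eq_false hM h2 fun m hm => ?_
      rw [h1]
      refine hxy j m (hm.trans_le ?_)
      cases y j
      · exact le_rfl
      · exact hd
    · cases ht : block M r (x 0 ^^ s.1) s.2 (y j) with
      | none => rfl
      | some t =>
        have h3 := state_add h2 (fun m hm => by rw [h1]; exact hxy j m hm) (block_spec hb hr ht)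
        have h4 := hM.forb h3
        rw [← blockPos_succ, hxy.start hb, Nat.bodd_succ, ← h1, Bool.xor_not] at h4
        exact h4

end Basic

theorem Valid.closes_eq_false {b r d : ℕ} (hb : 1 < b) (hr : b ≡ r + 1 [MOD 16]) (hd : d ≤ b)
    (n : ℕ) : ∀ (S : Type) [DecidableEq S] (M : Scanner S) (X : ℕ → ℕ → Bool) (P : ℕ → Bool),
      (∀ i, IsCoding b (X i) (X (i + 1))) → M.Valid (X 0) P → closes r d n S M = false := by
  induction n with
  | zero => intros; rfl
  | succ n ih =>
    intro S _ M X P hX hM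
    have h1 := hM.starting
    have h2 := ih _ _ (fun i => X (i + 1)) _ (fun i => hX (i + 1)) (h1.lift hb hr hd (hX 0))
    have h3 := h1.forb (j := 0) rfl
    rw [closes, List.all_eq_false]
    refine ⟨X 0 0, by cases X 0 0 <;> simp, ?_⟩
    rw [h2, Bool.or_false]
    change (M.starting (X 0 0)).forb M.initial (X 0 0) = false at h3
    rw [h3]
    decide

/-- The scanner for `X 3` in a chain of codings with first letters `false`, `true`, `false`,
`true`. The components of a state are: whether the next letter has to be `false`, and the parities
of the positions in `X 3`, `X 2` and `X 1`. -/
def base : Scanner (Bool × Bool × Bool × Bool) where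
  initial := (false, false, false, false)
  isInit s := !s.2.1 && !s.2.2.1 && !s.2.2.2
  step s c := match s, c with
    | (_, false, false, false), false => some (false, true, true, true)
    | (_, false, false, true), false => some (false, true, true, false)
    | (_, false, true, false), false => some (false, true, false, true)
    | (_, false, true, true), false => some (false, true, false, false)
    | (_, true, false, false), false => some (false, false, true, false)
    | (_, true, false, true), false => some (true, false, true, true)
    | (_, true, true, false), false => some (false, false, false, false)
    | (_, true, true, true), false => some (false, false, false, true)
    | (_, false, f, g), true => some (false, true, f, g)
    | (_, true, f, g), true => some (f && g, false, f, g)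
  pref s := some (!(s.2.2.1 ^^ s.2.2.2))
  forb s c := s.1 && c

theorem closes_two : closes 1 2 8 _ ((base.starting true).lift 1 2 true) = true := by
  decide +kernel

theorem closes_four : ∀ i < 8,
    closes (2 * i + 1) 4 8 _ ((base.starting true).lift (2 * i + 1) 4 true) = true := by
  decide +kernel

end Scanner

/-! ### The first letters of the iterated codings of a Lyndon word -/

/-- The preference of the second coding of a Lyndon word, if the first coding begins with `true`. -/
def codingPref (b : ℕ) (v : ℕ → Bool) (k : ℕ) : Bool :=
  (blockPos b v k).bodd == !k.bodd

section FirstLetters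

variable {b : ℕ} {w u v s r : ℕ → Bool}

theorem eq_false_of_prefers_false (hb : 1 < b) (hwu : IsCoding b w u)
    (hw : ∀ j, Prefers w (fun n => w (j + n)) fun _ => false) : w 0 = false := by
  by_contra h
  refine h (hw (blockPos b u 1) 0 (fun l hl => absurd hl (Nat.not_lt_zero _)) ?_)
  change w 0 ≠ w (blockPos b u 1 + 0)
  rw [add_zero, hwu.start hb]
  cases w 0 <;> decide

theorem prefers_coding (hb : 1 < b) (hwu : IsCoding b w u)
    (hw : ∀ j, Prefers w (fun n => w (j + n)) fun _ => false) {j : ℕ} (hj : j.bodd = false) :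
    Prefers u (fun n => u (j + n)) fun k => !k.bodd := by
  have h := Prefers.lift hb hwu (hwu.suffix hb hj)
    (by rw [add_zero, hwu.start hb, hj, Bool.xor_false]) (hw _)
  have e : liftPref b w u (fun _ => false) = fun k => !k.bodd := by
    funext k
    simp [liftPref, eq_false_of_prefers_false hb hwu hw]
  rwa [e] at h

theorem coding_zero_eq_true (hb : 1 < b) (hbe : b.bodd = false) (huv : IsCoding b u v)
    (hvs : IsCoding b v s)
    (hu : ∀ {j}, j.bodd = false → Prefers u (fun n => u (j + n)) fun k => !k.bodd) :
    u 0 = true := by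
  by_contra h0
  rw [Bool.not_eq_true] at h0
  have heven : ∀ j, j.bodd = false → u j = false := by
    intro j hj
    by_contra hne
    have := hu hj 0 (fun l hl => absurd hl (Nat.not_lt_zero _)) (by rw [h0]; exact Ne.symm hne)
    rw [h0] at this
    exact absurd this (by decide)
  have hv : ∀ k, blockPos b v k = k ∧ v k = false := by
    have hstep : ∀ k, blockPos b v k = k → v k = false := by
      intro k hk
      by_contra hv
      rw [Bool.not_eq_false] at hv
      cases hp : k.bodd
      · have h1 := huv.start hb (k + 1)
        have h2 := bodd_blockPos_succ (y := v) hbe k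
        rw [hk, hp, hv] at h2
        rw [heven _ h2, h0, Nat.bodd_succ, hp] at h1
        exact absurd h1 (by decide)
      · have h1 := huv k 1 (by rw [hv]; exact hb)
        rw [hk, heven _ (by rw [Nat.bodd_succ, hp]; rfl), h0, hp] at h1
        exact absurd h1 (by decide)
    intro k
    induction k with
    | zero => exact ⟨rfl, hstep 0 rfl⟩
    | succ k ih =>
      have : blockPos b v (k + 1) = k + 1 := by rw [blockPos_succ, ih.1, ih.2]; rfl
      exact ⟨this, hstep _ this⟩
  have h1 := hvs.start hb 1
  rw [(hv _).2, (hv 0).2] at h1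
  exact absurd h1 (by decide)

theorem succ_eq_of_odd (hb : 1 < b) (hbe : b.bodd = false) (huv : IsCoding b u v)
    (hu : ∀ {j}, j.bodd = false → Prefers u (fun n => u (j + n)) fun k => !k.bodd)
    (hu0 : u 0 = true) (hv0 : v 0 = true) {k : ℕ} (hk : k.bodd = true) : v (k + 1) = v k := by
  have hu1 : u 1 = true := by
    have := huv 0 1 (by rw [hv0]; exact hb)
    rwa [blockPos_zero, zero_add, hu0] at this
  have hnext : ∀ j, j.bodd = false → u j = true → u (j + 1) = true := by
    intro j hj hj1
    by_contra hne
    have := hu hj 1 (fun l hl => ?_) (by rw [hu1]; exact Ne.symm hne)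
    · rw [hu1] at this
      exact absurd this (by decide)
    · obtain rfl : l = 0 := by omega
      exact hu0.trans hj1.symm
  have key : ∀ k, k.bodd = false →
      v k = !(blockPos b v k).bodd ∧ (blockPos b v (k + 1)).bodd = false := by
    intro k hk
    have h1 := huv.start hb (k + 1)
    rw [hu0, Nat.bodd_succ, hk] at h1
    have hv : v k = !(blockPos b v k).bodd := by
      cases hp : (blockPos b v k).bodd <;> by_contra hv
      · rw [Bool.not_false, Bool.not_eq_true] at hv
        have h2 := hnext _ hp (by rw [huv.start hb, hu0, hk]; rfl)
        rw [blockPos_succ, hv] at h1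
        exact absurd (h2.symm.trans h1) (by decide)
      · rw [Bool.not_true, Bool.not_eq_false] at hv
        obtain ⟨c, rfl⟩ : ∃ c, b = c + 1 := ⟨b - 1, by omega⟩
        rw [Nat.bodd_succ] at hbe
        have h2 := hnext (blockPos (c + 1) v k + c) (by rw [Nat.bodd_add, hp]; simpa using hbe)
          (by rw [huv k c (by rw [hv]; exact Nat.lt_succ_self c), hu0, hk]; rfl)
        rw [blockPos_succ, hv] at h1
        exact absurd (h2.symm.trans h1) (by decide)
    refine ⟨hv, ?_⟩
    rw [bodd_blockPos_succ hbe, hv]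
    cases (blockPos b v k).bodd <;> rfl
  rcases k with - | m
  · cases hk
  rw [Nat.bodd_succ, Bool.not_eq_true'] at hk
  rw [(key (m + 1 + 1) (by simp [hk])).1, bodd_blockPos_succ hbe, (key m hk).2]
  simp

theorem coding_coding_zero_eq_false (hb : 1 < b) (hbe : b.bodd = false) (huv : IsCoding b u v)
    (hvs : IsCoding b v s) (hsr : IsCoding b s r)
    (hu : ∀ {j}, j.bodd = false → Prefers u (fun n => u (j + n)) fun k => !k.bodd)
    (hu0 : u 0 = true) : v 0 = false := by
  by_contra hv0
  rw [Bool.not_eq_false] at hv0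
  have hodd := fun k => succ_eq_of_odd (k := k) hb hbe huv hu hu0 hv0
  cases hs0 : s 0
  · have hs : ∀ k, (blockPos b s (k + 1)).bodd = true ∧ s (k + 1) = true := by
      have hstep : ∀ k, (blockPos b s k).bodd = true → s k = true := by
        intro k hk
        by_contra hs
        rw [Bool.not_eq_true] at hs
        have h1 := hvs.start hb (k + 1)
        rw [blockPos_succ, hs] at h1
        have h2 := (hodd _ hk).symm.trans h1
        rw [hvs.start hb, Nat.bodd_succ] at h2
        revert h2
        cases v 0 <;> cases k.bodd <;> decide
      intro k
      induction k with
      | zero =>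
        have : (blockPos b s 1).bodd = true := by
          simp [bodd_blockPos_succ hbe, hs0]
        exact ⟨this, hstep _ this⟩
      | succ k ih =>
        have : (blockPos b s (k + 1 + 1)).bodd = true := by
          rw [bodd_blockPos_succ hbe, ih.1, ih.2]; rfl
        exact ⟨this, hstep _ this⟩
    have h1 := hsr.start hb 2
    have h2 := le_psum (fun i => blockLen_pos hb (r i)) 2
    obtain ⟨m, hm⟩ : ∃ m, blockPos b r 2 = m + 1 := ⟨blockPos b r 2 - 1, by
      change 2 ≤ blockPos b r 2 at h2; omega⟩
    rw [hm, (hs m).2, hs0] at h1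
    exact absurd h1 (by decide)
  · obtain ⟨c, rfl⟩ : ∃ c, b = c + 1 := ⟨b - 1, by omega⟩
    have h1 := hvs.start hb 1
    have h2 := hvs 0 c (by rw [hs0]; exact Nat.lt_succ_self c)
    rw [Nat.bodd_succ, Bool.not_eq_false'] at hbe
    rw [blockPos_zero, zero_add] at h2
    rw [blockPos_succ, hs0, blockPos_zero, zero_add] at h1
    have h3 := (hodd c hbe).symm.trans h1
    rw [h2, hv0] at h3
    exact absurd h3 (by decide)

theorem prefers_coding_coding (hb : 1 < b) (huv : IsCoding b u v)
    (hu : ∀ {j}, j.bodd = false → Prefers u (fun n => u (j + n)) fun k => !k.bodd)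
    (hu0 : u 0 = true) {j : ℕ} (hj : j.bodd = false) (hj' : (blockPos b v j).bodd = false) :
    Prefers v (fun n => v (j + n)) (codingPref b v) := by
  have h := Prefers.lift hb huv (huv.suffix hb hj)
    (by rw [add_zero, huv.start hb, hj, Bool.xor_false]) (hu hj')
  have e : liftPref b u v (fun k => !k.bodd) = codingPref b v := by
    funext k
    simp [liftPref, codingPref, hu0]
  rwa [e] at h

theorem prefers_coding_coding_last (hb : 1 < b) (hbe : b.bodd = false) (huv : IsCoding b u v)
    (hu : ∀ {j}, j.bodd = false → Prefers u (fun n => u (j + n)) fun k => !k.bodd)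
    (hu0 : u 0 = true) {p : ℕ} (hp : p.bodd = false) (hp' : (blockPos b v p).bodd = true)
    (hv : v p = true) :
    Prefers v (fun n => if n = 0 then false else v (p + n)) (codingPref b v) := by
  have hlast : u (blockPos b v p + (b - 1)) = u 0 := by
    rw [huv p (b - 1) (by rw [hv]; change b - 1 < b; omega), hp, Bool.xor_false]
  have hodd : (b - 1).bodd = true := by
    obtain ⟨c, rfl⟩ : ∃ c, b = c + 1 := ⟨b - 1, by omega⟩
    rwa [Nat.bodd_succ, Bool.not_eq_false'] at hbe
  have h := Prefers.lift hb huv (huv.suffix_last hb hp hv) hlast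
    (hu (by rw [Nat.bodd_add, hp', hodd]; rfl))
  have e : liftPref b u v (fun k => !k.bodd) = codingPref b v := by
    funext k
    simp [liftPref, codingPref, hu0]
  rwa [e] at h

end FirstLetters

/-! ### The first letter of the third coding -/

section ThirdCoding

variable {b : ℕ} {v s r : ℕ → Bool}

theorem bodd_blockPos_alternating (hbe : b.bodd = false) {c : ℕ}
    (hv : ∀ k < 2 * c, v k = k.bodd) : (blockPos b v (2 * c)).bodd = c.bodd := by
  induction c with
  | zero => rfl
  | succ c ih =>
    rw [Nat.mul_succ, bodd_blockPos_succ hbe, bodd_blockPos_succ hbe,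
      ih fun k hk => hv k (by omega), hv (2 * c) (by omega), hv (2 * c + 1) (by omega)]
    cases h : c.bodd <;> simp [h]

theorem third_coding_one_eq_false (hb : 1 < b) (hbe : b.bodd = false) (hvs : IsCoding b v s)
    (hv0 : v 0 = false)
    (hlast : ∀ {p}, p.bodd = false → (blockPos b v p).bodd = true → v p = true →
      Prefers v (fun n => if n = 0 then false else v (p + n)) (codingPref b v))
    (hs0 : s 0 = false) : s 1 = false := by
  by_contra hs1
  rw [Bool.not_eq_false] at hs1
  obtain ⟨c, rfl⟩ : ∃ c, b = c + 1 := ⟨b - 1, by omega⟩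
  have hc : c.bodd = true := by rwa [Nat.bodd_succ, Bool.not_eq_false'] at hbe
  have hp1 : blockPos (c + 1) s 1 = 1 := by rw [blockPos_succ, hs0]; rfl
  have hp2 : blockPos (c + 1) s 2 = c + 2 := by
    rw [blockPos_succ, hs1, hp1]
    change 1 + (c + 1) = _
    omega
  have h1 : ∀ m < c + 1, v (1 + m) = true := by
    intro m hm
    have := hvs 1 m (by rw [hs1]; exact hm)
    rw [hp1, hv0] at this
    exact this
  have h2 : v (c + 2) = false := by
    have := hvs.start hb 2
    rw [hp2, hv0] at this
    exact this
  have hpar : ∀ m ≤ c, (blockPos (c + 1) v (1 + m)).bodd = true := by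
    intro m hm
    rw [bodd_blockPos_add hbe (c := true) fun i hi => h1 i (by omega), bodd_blockPos_succ hbe, hv0]
    simp
  have hvc : v c = true := by
    have := h1 (c - 1) (by omega)
    rwa [Nat.add_sub_cancel' (by omega)] at this
  have hpc : (blockPos (c + 1) v c).bodd = true := by
    have := hpar (c - 1) (by omega)
    rwa [Nat.add_sub_cancel' (by omega)] at this
  refine (hlast (p := 2) rfl (hpar 1 (by omega)) (h1 1 (by omega))).contradiction (k := c) hvc
    ((if_neg (by omega)).trans (add_comm 2 c ▸ h2)) (by rw [codingPref, hpc, hc]; rfl)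
    fun l hl => ?_
  rcases l with - | l
  · exact hv0
  · refine Eq.trans ?_ (if_neg (by omega)).symm
    have e := h1 l (by omega)
    have e' := h1 (l + 2) (by omega)
    rw [show l + 1 = 1 + l by omega, e, show 2 + (1 + l) = 1 + (l + 2) by omega, e']

theorem third_coding_one_eq_true (hb : 1 < b) (hbe : b.bodd = false) (hvs : IsCoding b v s)
    (hsr : IsCoding b s r) (hv0 : v 0 = false)
    (heven : ∀ {j}, j.bodd = false → (blockPos b v j).bodd = false →
      Prefers v (fun n => v (j + n)) (codingPref b v))
    (hlast : ∀ {p}, p.bodd = false → (blockPos b v p).bodd = true → v p = true →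
      Prefers v (fun n => if n = 0 then false else v (p + n)) (codingPref b v))
    (hs0 : s 0 = false) : s 1 = true := by
  by_contra hs1
  rw [Bool.not_eq_true] at hs1
  obtain ⟨c, hc⟩ : ∃ c, b = 2 * c := by
    have := Nat.bodd_add_div2 b
    rw [hbe] at this
    exact ⟨b.div2, by simpa using this.symm⟩
  have hr0 : r 0 = true := by
    by_contra hr0
    rw [Bool.not_eq_true] at hr0
    have := hsr.start hb 1
    rw [blockPos_succ, hr0, hs0] at this
    exact absurd (hs1.symm.trans this) (by decide)
  have hs : ∀ m < b, s m = false := by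
    intro m hm
    have := hsr 0 m (by rw [hr0]; exact hm)
    rw [blockPos_zero, zero_add, hs0] at this
    exact this
  have hsb : s b = true := by
    have := hsr.start hb 1
    rw [blockPos_succ, hr0, hs0, blockPos_zero, zero_add] at this
    exact this
  have hpos : ∀ k ≤ b, blockPos b s k = k := by
    intro k hk
    induction k with
    | zero => rfl
    | succ k ih => rw [blockPos_succ, ih (by omega), hs k (by omega)]; rfl
  have hposb : blockPos b s (b + 1) = 2 * b := by
    rw [blockPos_succ, hsb, hpos b le_rfl, two_mul]; rfl
  have hv : ∀ k ≤ b, v k = k.bodd := by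
    intro k hk
    have := hvs.start hb k
    rwa [hpos k hk, hv0, Bool.false_xor] at this
  have hvb : ∀ m < b, v (b + m) = false := by
    intro m hm
    have := hvs b m (by rw [hsb]; exact hm)
    rwa [hpos b le_rfl, hv0, hbe] at this
  have hv2b : ∀ m < blockLen b (s (b + 1)), v (2 * b + m) = true := by
    intro m hm
    have := hvs (b + 1) m hm
    rwa [hposb, hv0, Nat.bodd_succ, hbe] at this
  have hpar : ∀ k ≤ c, (blockPos b v (2 * k)).bodd = k.bodd := fun k hk =>
    bodd_blockPos_alternating hbe fun l hl => hv l (by omega)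
  have hv1 : v 1 = true := hv 1 hb.le
  cases hcb : c.bodd
  · obtain ⟨d, rfl⟩ : ∃ d, c = d + 2 := by
      rcases c with - | - | d
      · omega
      · cases hcb
      · exact ⟨d, rfl⟩
    have hd : d.bodd = false := by simpa using hcb
    have hpd : (blockPos b v (2 * d + 1)).bodd = true := by
      rw [bodd_blockPos_succ hbe, hpar d (by omega), hv _ (by omega)]
      simp [hd]
    have hz : v (4 + (2 * d + 1)) = false := by
      rw [show 4 + (2 * d + 1) = b + 1 by omega]
      exact hvb 1 hb
    refine (heven (j := 4) rfl (hpar 2 (by omega))).contradiction (c := true)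
      ((hv (2 * d + 1) (by omega)).trans (by simp)) hz (by simp [codingPref, hpd]) fun l hl => ?_
    rw [hv l (by omega), hv (4 + l) (by omega)]
    simp [Nat.bodd_add]
  · have hp2b : (blockPos b v (2 * b)).bodd = true := by
      have := hpar c le_rfl
      rw [← hc, hcb] at this
      rw [two_mul, bodd_blockPos_add hbe hvb, hbe, this]
      rfl
    have h2b : v (2 * b) = true := hv2b 0 (blockLen_pos hb _)
    have h3 := hlast (p := 2 * b) (by simp) hp2b h2b
    have hp1 : (blockPos b v 1).bodd = true := by
      simp [bodd_blockPos_succ hbe, hv0]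
    cases hsb1 : s (b + 1)
    · have hz : v (2 * b + 1) = false := by
        have := hvs.start hb (b + 2)
        rwa [blockPos_succ, hposb, hsb1, hv0, Nat.bodd_add, hbe] at this
      refine h3.contradiction (k := 1) hv1 hz (by rw [codingPref, hp1]; rfl) fun l hl => ?_
      obtain rfl : l = 0 := by omega
      exact hv0
    · rw [hsb1] at hv2b
      change ∀ m < b, _ at hv2b
      rcases (show b = 2 ∨ 2 < b by omega) with rfl | hb2
      · have hr1 : r 1 = true := by
          by_contra hr1
          rw [Bool.not_eq_true] at hr1
          have := hsr.start hb 2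
          rw [blockPos_succ, blockPos_succ, hr0, hr1, hs0] at this
          exact absurd (hsb1.symm.trans this) (by decide)
        have hs4 : s 4 = false := by
          have := hsr.start hb 2
          rwa [blockPos_succ, blockPos_succ, hr0, hr1, hs0] at this
        have hv6 : v 6 = false := by
          have := hvs.start hb 4
          rwa [blockPos_succ, hposb, hsb1, hv0] at this
        have hv7 : v 7 = true := by
          have := hvs.start hb 5
          rwa [blockPos_succ, blockPos_succ, hposb, hsb1, hs4, hv0] at this
        have hv3 : v 3 = false := hvb 1 hb
        have hp3 : (blockPos 2 v 3).bodd = false := by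
          rw [bodd_blockPos_succ hbe, hpar 1 (by omega), show v 2 = false from hvb 0 (by omega)]
          rfl
        refine h3.contradiction (k := 3) hv3 hv7 (by rw [codingPref, hp3]; rfl) fun l hl => ?_
        interval_cases l
        · exact hv0
        · exact hv1.trans (hv2b 1 hb).symm
        · exact (hvb 0 (by omega)).trans hv6.symm
      · refine h3.contradiction (k := 2) (hv 2 (by omega)) (hv2b 2 hb2)
          (by rw [codingPref, hpar 1 (by omega)]; rfl) fun l hl => ?_
        interval_cases l
        · exact hv0
        · exact hv1.trans (hv2b 1 hb).symm

theorem base_valid (hb : 1 < b) (hbe : b.bodd = false) (hvs : IsCoding b v s) (hv0 : v 0 = false)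
    (heven : ∀ {j}, j.bodd = false → (blockPos b v j).bodd = false →
      Prefers v (fun n => v (j + n)) (codingPref b v))
    (hlast : ∀ {p}, p.bodd = false → (blockPos b v p).bodd = true → v p = true →
      Prefers v (fun n => if n = 0 then false else v (p + n)) (codingPref b v))
    (hs0 : s 0 = true) : Scanner.base.Valid s (liftPref b v s (codingPref b v)) := by
  have hblock : ∀ k m, m < blockLen b (s k) → v (blockPos b s k + m) = k.bodd := by
    intro k m hm
    rw [hvs k m hm, hv0, Bool.false_xor]
  have hst : ∀ {k t}, Scanner.base.state s k = some t →
      t.2 = (k.bodd, (blockPos b s k).bodd, (blockPos b v (blockPos b s k)).bodd) ∧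
      (t.1 = true → k.bodd = false ∧ ∃ p, blockPos b s k = p + 1 ∧ p.bodd = false ∧
        (blockPos b v p).bodd = true ∧ v p = true) := by
    intro k
    induction k with
    | zero =>
      intro t ht
      cases ht
      exact ⟨by simp [Scanner.base], fun h => by cases h⟩
    | succ k ih =>
      intro t ht
      obtain ⟨q, hq, ht⟩ := Option.bind_eq_some_iff.1 ht
      obtain ⟨h1, -⟩ := ih hq
      have h2 := bodd_blockPos_succ (y := s) hbe k
      have h3 := bodd_blockPos_add hbe (hblock k)
      rw [← blockPos_succ, bodd_blockLen hbe] at h3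
      have h4 : k.bodd = true → (blockPos b s k).bodd = s k →
          (blockPos b v (blockPos b s k)).bodd = true →
          ∃ p, blockPos b s (k + 1) = p + 1 ∧ p.bodd = false ∧
            (blockPos b v p).bodd = true ∧ v p = true := by
        intro hk hp hp'
        have hlen := blockLen_pos hb (s k)
        have hbl := bodd_blockLen hbe (s k)
        obtain ⟨m, hm⟩ : ∃ m, blockLen b (s k) = m + 1 := ⟨blockLen b (s k) - 1, by omega⟩
        rw [hm, Nat.bodd_succ, Bool.not_eq_eq_eq_not, Bool.not_not] at hbl
        refine ⟨blockPos b s k + m, by rw [blockPos_succ, hm, add_assoc], ?_, ?_,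
          (hblock k m (by omega)).trans hk⟩
        · rw [Nat.bodd_add, hp, hbl, Bool.xor_self]
        · rw [bodd_blockPos_add hbe fun i hi => hblock k i (by omega), hp', hk]
          simp
      obtain ⟨fl, q2⟩ := q
      simp only at h1
      subst h1
      rw [Nat.bodd_succ, h2, h3]
      revert ht h4
      generalize s k = c
      generalize k.bodd = f3
      generalize (blockPos b s k).bodd = f2
      generalize (blockPos b v (blockPos b s k)).bodd = f1
      intro h4 ht
      cases f3 <;> cases f2 <;> cases f1 <;> cases c <;> cases ht <;>
        first
          | exact ⟨rfl, fun _ => ⟨rfl, h4 rfl rfl rfl⟩⟩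
          | exact ⟨rfl, fun h => by cases h⟩
  refine ⟨fun {k t p} ht hp => ?_, fun {j t} ht hi => ?_, fun {j t} ht => ?_⟩
  · obtain ⟨h1, -⟩ := hst ht
    have h2 := hblock k 0 (blockLen_pos hb _)
    rw [add_zero] at h2
    simp only [Scanner.base, Option.some.injEq] at hp
    rw [← hp, h1, liftPref, codingPref, bodd_blockPos_succ hbe, Nat.bodd_succ, h2, hv0]
    generalize k.bodd = f3
    generalize (blockPos b s k).bodd = f2
    generalize (blockPos b v (blockPos b s k)).bodd = f1
    revert f1 f2 f3
    decide
  · obtain ⟨h1, -⟩ := hst ht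
    simp only [Scanner.base, h1, Bool.and_eq_true, Bool.not_eq_true'] at hi
    obtain ⟨⟨h3, h2⟩, h4⟩ := hi
    exact Prefers.lift hb hvs (hvs.suffix hb h3)
      (by rw [add_zero, hvs.start hb, h3, Bool.xor_false]) (heven h2 h4)
  · by_contra hne
    simp only [Scanner.base, Bool.not_eq_false, Bool.and_eq_true] at hne
    obtain ⟨hj, p, hp, hpe, hpp, hvp⟩ := (hst ht).2 hne.1
    have hz : ∀ m < b, v (p + (m + 1)) = false := by
      intro m hm
      have := hblock j m (by rw [hne.2]; exact hm)
      rwa [hp, hj, add_assoc, add_comm 1 m] at this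
    have hv : ∀ m < b, v (0 + m) = false := by
      intro m hm
      have := hblock 0 m (by rw [hs0]; exact hm)
      rwa [blockPos_zero] at this
    have hvb : v b = true := by
      have := hvs.start hb 1
      rwa [blockPos_succ, hs0, hv0, blockPos_zero, zero_add] at this
    have hpb := bodd_blockPos_add hbe hv
    obtain ⟨c, hc⟩ : ∃ c, b = c + 1 := ⟨b - 1, by omega⟩
    have hzb := hz c (by omega)
    rw [← hc] at hzb
    rw [zero_add, hbe] at hpb
    refine (hlast hpe hpp hvp).contradiction hvb ((if_neg (by omega)).trans hzb)
      (by simp [codingPref, hpb, hbe]) fun l hl => ?_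
    have hvl := hv l hl
    rw [zero_add] at hvl
    rcases l with - | l
    · exact hvl
    · exact hvl.trans ((if_neg (by omega)).trans (hz l (by omega))).symm

theorem third_coding_zero_eq_true (hb : 1 < b) (hbe : b.bodd = false) (hvs : IsCoding b v s)
    (hsr : IsCoding b s r) (hv0 : v 0 = false)
    (heven : ∀ {j}, j.bodd = false → (blockPos b v j).bodd = false →
      Prefers v (fun n => v (j + n)) (codingPref b v))
    (hlast : ∀ {p}, p.bodd = false → (blockPos b v p).bodd = true → v p = true →
      Prefers v (fun n => if n = 0 then false else v (p + n)) (codingPref b v)) : s 0 = true := by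
  by_contra hs0
  rw [Bool.not_eq_true] at hs0
  exact absurd ((third_coding_one_eq_true hb hbe hvs hsr hv0 heven hlast hs0).symm.trans
    (third_coding_one_eq_false hb hbe hvs hv0 hlast hs0)) (by decide)

end ThirdCoding

theorem not_prefers_of_chain {b : ℕ} {X : ℕ → ℕ → Bool} (hb : 1 < b) (hbe : b.bodd = false)
    (hX : ∀ i, IsCoding b (X i) (X (i + 1)))
    (hw : ∀ j, Prefers (X 0) (fun n => X 0 (j + n)) fun _ => false) : False := by
  have hu {j : ℕ} (hj : j.bodd = false) := prefers_coding hb (hX 0) hw hj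
  have hu0 := coding_zero_eq_true hb hbe (hX 1) (hX 2) hu
  have hv0 := coding_coding_zero_eq_false hb hbe (hX 1) (hX 2) (hX 3) hu hu0
  have heven {j : ℕ} (h1 : j.bodd = false) (h2 : (blockPos b (X 2) j).bodd = false) :=
    prefers_coding_coding hb (hX 1) hu hu0 h1 h2
  have hlast {p : ℕ} (h1 : p.bodd = false) (h2 : (blockPos b (X 2) p).bodd = true)
      (h3 : X 2 p = true) := prefers_coding_coding_last hb hbe (hX 1) hu hu0 h1 h2 h3
  have hs0 := third_coding_zero_eq_true hb hbe (hX 2) (hX 3) hv0 heven hlast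
  have hM := (base_valid hb hbe (hX 2) hv0 heven hlast hs0).starting
  rw [hs0] at hM
  have key : ∀ r d, b ≡ r + 1 [MOD 16] → d ≤ b →
      Scanner.closes r d 8 _ ((Scanner.base.starting true).lift r d true) = false := by
    intro r d hr hd
    have h := hM.lift hb hr hd (hX 3)
    rw [hs0] at h
    exact Scanner.Valid.closes_eq_false hb hr hd 8 _ _ (fun i => X (4 + i)) _
      (fun i => hX (4 + i)) h
  have hmod : b % 2 = 0 := by rw [Nat.mod_two_of_bodd, hbe]; rfl
  rcases (show b = 2 ∨ 4 ≤ b by omega) with rfl | hb4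
  · exact absurd (Scanner.closes_two.symm.trans (key 1 2 rfl le_rfl)) (by decide)
  · have h16 : b ≡ 2 * ((b + 14) % 16 / 2) + 1 + 1 [MOD 16] := by
      unfold Nat.ModEq
      omega
    exact absurd ((Scanner.closes_four _ (by omega)).symm.trans (key _ 4 h16 hb4)) (by decide)

theorem SmoothChain.isCoding {b : ℕ} {W : ℕ → ℕ → ℕ} (hb : 1 < b) (hW : SmoothChain 1 b W)
    (i : ℕ) : IsCoding b (fun n => decide (W i n = b)) (fun n => decide (W (i + 1) n = b)) := by
  have hlen : (fun n => blockLen b (decide (W (i + 1) n = b))) = W (i + 1) := by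
    funext n
    rcases (hW (i + 1)).1 n with h | h <;> rw [h]
    · simp [blockLen, hb.ne]
    · simp [blockLen]
  have hpos : ∀ n, 0 < W (i + 1) n := by
    intro n
    rw [← hlen]
    exact blockLen_pos hb _
  intro k m hm
  replace hm : m < W (i + 1) k := by rwa [← hlen]
  have h1 := congrFun (hW i).2 (psum (W (i + 1)) k + m)
  rw [expand, blockIdx_psum_add hpos hm, Nat.mod_two_of_bodd] at h1
  simp only [blockPos, hlen, h1]
  rcases (hW i).1 0 with h | h <;> rw [h] <;> cases k.bodd <;> simp [hb.ne, hb.ne']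

theorem IsInfLyndon.prefers {b : ℕ} {w : ℕ → ℕ} (hb : 1 < b) (hw : ∀ n, w n = 1 ∨ w n = b)
    (h : IsInfLyndon w) (j : ℕ) :
    Prefers (fun n => decide (w n = b)) (fun n => decide (w (j + n) = b)) fun _ => false := by
  intro k hk hne
  rcases j with - | j
  · simp at hne
  obtain ⟨l, hl, hlt⟩ := h (j + 1) (by omega)
  simp only [add_comm _ (j + 1)] at hl hlt
  have heq : ∀ m n, decide (w m = b) = decide (w n = b) → w m = w n := by
    intro m n hmn
    rcases hw m with h1 | h1 <;> rcases hw n with h2 | h2 <;> simp [h1, h2, hb.ne] at hmn ⊢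
  obtain hlk | rfl | hlk := lt_trichotomy l k
  · have := heq _ _ (hk l hlk)
    rw [← this] at hlt
    exact absurd hlt (lt_irrefl _)
  · have : w l ≠ b := by
      have h1 := hw (j + 1 + l)
      omega
    simpa using this
  · have := hl k hlk
    simp [this] at hne

/-- Over `{1 < b}` with `b` even, no infinite smooth word is an infinite Lyndon
word (in particular, over `{1, 2}` no infinite smooth word — e.g. no word in the
class containing the Kolakoski word — is an infinite Lyndon word). -/
theorem no_smooth_lyndon_one_even (b : ℕ) (hbe : Even b) (h1b : 1 < b) :
    ∀ w : ℕ → ℕ, IsSmooth 1 b w → ¬ IsInfLyndon w := by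
  rintro w ⟨W, rfl, hW⟩ hL
  have hodd : b.bodd = false := by
    have := Nat.mod_two_of_bodd b
    rw [Nat.even_iff.1 hbe] at this
    cases h : b.bodd <;> simp [h] at this ⊢
  exact not_prefers_of_chain h1b hodd (hW.isCoding h1b) (hL.prefers h1b (hW 0).1)
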